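/- (Theorem 1, recovery form.) There exist coefficient vectors v : Fin n → (ZMod k_A → ℝ) with v c q = 0 whenever q ∉ T_c, such that the following holds: for all positive integers t and α, for all data blocks A_q : Matrix (Fin t) (Fin α) ℝ (q ∈ ZMod k_A), for all x : Fin t → ℝ, and for every straggler set S ⊆ Fin n with |S| = s, letting Ã_c = Σ_{q} (v c q) • A_q be the coded submatrix of client c, there exist decoding coefficients d : ZMod k_A → (Fin n → ℝ) such that for every q ∈ ZMod k_A, (A_q)ᵀ x = Σ_{c ∉ S} (d q c) • (Ã_c)ᵀ x. That is, the server recovers Aᵀx from the results returned by any n − s = k_A non-straggler clients. -/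

import Mathlib

open Matrix

/-- The cyclic interval `{a, a+1, …, a+ω−1}` of length `ω` starting at `a` in `ZMod k`. -/
def Icyc (k ω : ℕ) (a : ZMod k) : Finset (ZMod k) :=
  (Finset.range ω).image (fun j : ℕ => a + (j : ZMod k))

/-- The support assignment of Algorithm 1: client `i < k_A` gets the cyclic interval of
length `ω_A = s+1` starting at `i`, and passive client `k_A + j` gets the one starting
at `j`. -/
def Tsup (kA s : ℕ) (c : Fin (kA + s)) : Finset (ZMod kA) :=
  if (c : ℕ) < kA then Icyc kA (s + 1) ((c : ℕ) : ZMod kA)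
  else Icyc kA (s + 1) (((c : ℕ) - kA : ℕ) : ZMod kA)

/-- A family of supports admits real coefficients for which every square submatrix whose rows are
matched to the columns inside their supports is nonsingular. -/
theorem exists_supported_matrix_det_ne_zero {ι κ : Type*} [Fintype ι] [DecidableEq ι]
    [Fintype κ] [DecidableEq κ] (T : ι → Finset κ) :
    ∃ v : ι → κ → ℝ, (∀ c q, q ∉ T c → v c q = 0) ∧
      ∀ e : κ → ι, Function.Injective e → (∀ q, q ∈ T (e q)) →
        ((Matrix.of v).submatrix e id).det ≠ 0 := by
  classical
  let M : Matrix ι κ (MvPolynomial (ι × κ) ℝ) :=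
    Matrix.of fun c q => if q ∈ T c then MvPolynomial.X (c, q) else 0
  have eval_det (w : ι × κ → ℝ) (e : κ → ι) :
      MvPolynomial.eval w (M.submatrix e id).det =
        ((Matrix.of fun c q => if q ∈ T c then w (c, q) else 0).submatrix e id).det := by
    rw [RingHom.map_det]
    congr 1
    ext p q
    simp only [M, RingHom.mapMatrix_apply, Matrix.map_apply, Matrix.submatrix_apply,
      Matrix.of_apply, id]
    split_ifs <;> simp
  let E : Finset (κ → ι) :=
    Finset.univ.filter fun e => Function.Injective e ∧ ∀ q, q ∈ T (e q)
  have prod_ne : ∏ e ∈ E, (M.submatrix e id).det ≠ 0 := by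
    refine Finset.prod_ne_zero_iff.2 fun e he => ?_
    obtain ⟨hinj, hmem⟩ := (Finset.mem_filter.1 he).2
    intro h0
    have h1 := eval_det (fun cq => if e cq.2 = cq.1 then 1 else 0) e
    have hone : ((Matrix.of fun c q => if q ∈ T c then
        (if e q = c then (1 : ℝ) else 0) else 0).submatrix e id) = 1 := by
      ext p q
      by_cases hpq : p = q
      · subst hpq
        simp [hmem]
      · simp [hpq, hinj.eq_iff, Ne.symm hpq]
    rw [h0, hone] at h1
    simp at h1
  obtain ⟨w, hw⟩ : ∃ w, MvPolynomial.eval w (∏ e ∈ E, (M.submatrix e id).det) ≠ 0 := by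
    by_contra! h
    exact prod_ne (MvPolynomial.funext fun w => by simpa using h w)
  refine ⟨fun c q => if q ∈ T c then w (c, q) else 0, fun c q h => if_neg h, ?_⟩
  intro e hinj hmem
  rw [map_prod, Finset.prod_ne_zero_iff] at hw
  rw [← eval_det]
  exact hw e (Finset.mem_filter.2 ⟨Finset.mem_univ _, hinj, hmem⟩)

theorem ZMod.eq_univ_of_forall_add_one_mem {k : ℕ} [NeZero k] {E : Finset (ZMod k)}
    (hE : E.Nonempty) (h : ∀ a ∈ E, a + 1 ∈ E) : E = Finset.univ := by
  obtain ⟨a, ha⟩ := hE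
  have key (m : ℕ) : a + m ∈ E := by
    induction m with
    | zero => simpa using ha
    | succ m ih => simpa [add_assoc] using h _ ih
  refine Finset.eq_univ_of_forall fun b => ?_
  simpa using key (b - a).val

theorem mem_Icyc {k ω : ℕ} {a b : ZMod k} : b ∈ Icyc k ω a ↔ ∃ j < ω, a + (j : ZMod k) = b := by
  simp [Icyc]

/-- Cyclic intervals of length `ω + 1` starting at the points of `D` cover at least
`min k (|D| + ω)` residues. -/
theorem min_le_card_biUnion_Icyc {k : ℕ} [NeZero k] (ω : ℕ) {D : Finset (ZMod k)}
    (hD : D.Nonempty) : min k (D.card + ω) ≤ (D.biUnion (Icyc k (ω + 1))).card := by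
  induction ω with
  | zero =>
    refine (min_le_right _ _).trans (Finset.card_le_card fun a ha => ?_)
    exact Finset.mem_biUnion.2 ⟨a, ha, mem_Icyc.2 ⟨0, by simp⟩⟩
  | succ ω ih =>
    have hsub : D.biUnion (Icyc k (ω + 1)) ⊆ D.biUnion (Icyc k (ω + 1 + 1)) := by
      refine Finset.biUnion_mono fun a _ b hb => ?_
      obtain ⟨j, hj, rfl⟩ := mem_Icyc.1 hb
      exact mem_Icyc.2 ⟨j, by omega, rfl⟩
    by_cases hclosed : ∀ a ∈ D.biUnion (Icyc k (ω + 1)), a + 1 ∈ D.biUnion (Icyc k (ω + 1))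
    · obtain ⟨a, ha⟩ := hD
      have hne : (D.biUnion (Icyc k (ω + 1))).Nonempty :=
        ⟨a, Finset.mem_biUnion.2 ⟨a, ha, mem_Icyc.2 ⟨0, by simp⟩⟩⟩
      have hcard := Finset.card_le_card hsub
      rw [ZMod.eq_univ_of_forall_add_one_mem hne hclosed, Finset.card_univ, ZMod.card] at hcard
      exact (min_le_left _ _).trans hcard
    · push Not at hclosed
      obtain ⟨b, hb, hb'⟩ := hclosed
      have hmem : b + 1 ∈ D.biUnion (Icyc k (ω + 1 + 1)) := by
        obtain ⟨a, ha, hab⟩ := Finset.mem_biUnion.1 hb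
        obtain ⟨j, hj, rfl⟩ := mem_Icyc.1 hab
        exact Finset.mem_biUnion.2 ⟨a, ha, mem_Icyc.2 ⟨j + 1, by omega, by push_cast; ring⟩⟩
      have hlt := Finset.card_lt_card
        (Finset.ssubset_iff_subset_ne.2 ⟨hsub, fun h => hb' (h ▸ hmem)⟩)
      omega

/-- The first residue of the support of client `c`. -/
def supportStart (kA s : ℕ) (c : Fin (kA + s)) : ZMod kA :=
  if (c : ℕ) < kA then ((c : ℕ) : ZMod kA) else (((c : ℕ) - kA : ℕ) : ZMod kA)

theorem Tsup_eq_Icyc (kA s : ℕ) (c : Fin (kA + s)) :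
    Tsup kA s c = Icyc kA (s + 1) (supportStart kA s c) := by
  unfold Tsup supportStart
  split_ifs <;> rfl

theorem card_le_card_image_supportStart_add (kA s : ℕ) (U : Finset (Fin (kA + s))) :
    U.card ≤ (U.image (supportStart kA s)).card + s := by
  classical
  have hactive : (U.filter fun c : Fin (kA + s) => (c : ℕ) < kA).card ≤
      (U.image (supportStart kA s)).card := by
    refine Finset.card_le_card_of_injOn (supportStart kA s) (fun c hc => ?_) ?_
    · exact Finset.mem_coe.2 (Finset.mem_image_of_mem _ (Finset.mem_filter.1 hc).1)
    · intro c hc c' hc' h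
      have hlt := (Finset.mem_filter.1 hc).2
      have hlt' := (Finset.mem_filter.1 hc').2
      simp only [supportStart, if_pos hlt, if_pos hlt'] at h
      have hval := congrArg ZMod.val h
      rw [ZMod.val_natCast_of_lt hlt, ZMod.val_natCast_of_lt hlt'] at hval
      exact Fin.ext hval
  have hpassive : (U.filter fun c : Fin (kA + s) => ¬ (c : ℕ) < kA).card ≤ s := by
    have h := Finset.card_le_card_of_injOn (s := U.filter fun c : Fin (kA + s) => ¬ (c : ℕ) < kA)
      (t := Finset.range s) (fun c => (c : ℕ) - kA) ?_ ?_
    · simpa using h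
    · intro c hc
      have hge := (Finset.mem_filter.1 hc).2
      have := c.isLt
      simp only [Finset.coe_range, Set.mem_Iio]
      omega
    · intro c hc c' hc' h
      have hge := (Finset.mem_filter.1 hc).2
      have hge' := (Finset.mem_filter.1 hc').2
      apply Fin.ext
      simp only at h
      omega
  have := Finset.card_filter_add_card_filter_not (s := U) fun c : Fin (kA + s) => (c : ℕ) < kA
  omega

/-- Any `k_A` clients can be matched with the `k_A` blocks inside their supports. -/
theorem exists_equiv_mem_Tsup (kA s : ℕ) [NeZero kA] {R : Finset (Fin (kA + s))}
    (hR : R.card = kA) : ∃ e : ZMod kA ≃ R, ∀ q, q ∈ Tsup kA s (e q) := by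
  classical
  obtain ⟨f, hf, hmem⟩ := (Finset.all_card_le_biUnion_card_iff_exists_injective
    fun c : R => Tsup kA s c).1 fun U => by
      rcases U.eq_empty_or_nonempty with rfl | hU
      · simp
      have hle : U.card ≤ kA := by simpa [hR] using Finset.card_le_univ U
      have hstart := card_le_card_image_supportStart_add kA s (U.image Subtype.val)
      rw [Finset.card_image_of_injective _ Subtype.val_injective] at hstart
      have hcover := min_le_card_biUnion_Icyc s
        ((hU.image Subtype.val).image (supportStart kA s))
      rw [Finset.image_biUnion, Finset.image_biUnion] at hcover
      simp only [Tsup_eq_Icyc]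
      exact (le_min hle hstart).trans hcover
  have hbij : Function.Bijective f :=
    (Fintype.bijective_iff_injective_and_card f).2 ⟨hf, by simp [hR, ZMod.card]⟩
  refine ⟨(Equiv.ofBijective f hbij).symm, fun q => ?_⟩
  have h := hmem ((Equiv.ofBijective f hbij).symm q)
  rwa [Equiv.ofBijective_apply_symm_apply f hbij q] at h

/-- Theorem 1 (recovery form): there exist coefficient vectors supported on the
cyclic-interval support assignment of Algorithm 1 such that for any data blocks
`A_q`, any parameter vector `x`, and any straggler set `S` of size `s`, the server can
recover every `(A_q)ᵀ x` as a linear combination of the results `(Ã_c)ᵀ x` returned by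
the non-straggler clients, where `Ã_c = Σ_q (v c q) • A_q`. -/
theorem algorithm_one_recovery (kA s : ℕ) (hs : 1 ≤ s) (hsk : s < kA)
    [NeZero kA] :
    ∃ v : Fin (kA + s) → ZMod kA → ℝ,
      (∀ c q, q ∉ Tsup kA s c → v c q = 0) ∧
      ∀ (t α : ℕ), 0 < t → 0 < α →
        ∀ (A : ZMod kA → Matrix (Fin t) (Fin α) ℝ) (x : Fin t → ℝ)
          (S : Finset (Fin (kA + s))), S.card = s →
          ∃ d : ZMod kA → Fin (kA + s) → ℝ,
            ∀ q : ZMod kA,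
              (A q)ᵀ.mulVec x =
                ∑ c ∈ Sᶜ, d q c • ((∑ p : ZMod kA, v c p • A p)ᵀ.mulVec x) := by
  obtain ⟨v, hv, hdet⟩ := exists_supported_matrix_det_ne_zero (Tsup kA s)
  refine ⟨v, hv, fun t α _ _ A x S hS => ?_⟩
  obtain ⟨e, he⟩ := exists_equiv_mem_Tsup kA s (R := Sᶜ)
    (by rw [Finset.card_compl, Fintype.card_fin, hS, Nat.add_sub_cancel])
  set V := (Matrix.of v).submatrix (fun q => (e q : Fin (kA + s))) id with hV
  have hunit : IsUnit V.det :=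
    (hdet (fun q => e q) (Subtype.val_injective.comp e.injective) he).isUnit
  refine ⟨fun q c => if h : c ∈ Sᶜ then V⁻¹ q (e.symm ⟨c, h⟩) else 0, fun q => ?_⟩
  have hlin (c : Fin (kA + s)) : (∑ p : ZMod kA, v c p • A p)ᵀ.mulVec x =
      ∑ p : ZMod kA, v c p • (A p)ᵀ.mulVec x := by
    simp [Matrix.transpose_sum, Matrix.sum_mulVec, Matrix.smul_mulVec]
  have hrow (p : ZMod kA) : ∑ r, V⁻¹ q r * v (e r) p = if q = p then 1 else 0 := by
    have h := congrFun (congrFun (Matrix.nonsing_inv_mul V hunit) q) p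
    simpa [Matrix.mul_apply, Matrix.one_apply, hV] using h
  rw [← Finset.sum_coe_sort, ← e.sum_comp]
  simp only [Finset.coe_mem, dif_pos, Subtype.coe_eta, Equiv.symm_apply_apply, hlin,
    Finset.smul_sum, smul_smul]
  rw [Finset.sum_comm]
  simp only [← Finset.sum_smul, hrow, ite_smul, one_smul, zero_smul, Finset.sum_ite_eq,
    Finset.mem_univ, if_true]
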